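/- Set r = σ2²/σ1², W1 = (X1 − X2)/(1+r), W2 = (r X1 + X2)/(1+r), μ1 = (θ1 − θ2)/(1+r), and let δ_ψ(X) = W2 + ψ(W1) for a measurable ψ : ℝ^p → ℝ^p. Define R̲ = (1/σ_Y²)·( σ1²σ2²/(σ1²+σ2²) + (1/p)·inf{ E‖ψ(W1) − μ1‖² : (1+r)μ1 ∈ A } ), with W1 ~ N_p(μ1, (σ1²/(1+r)) I_p), and assume this infimum is finite and the suprema of E‖ψ(W1)−μ1‖² over the restriction are finite. Then for every c with 1 < c < c₀(1 + R̲), where c₀(s) is the unique root in (s,∞) of (1 − 1/c)s − log c, the predictive density q_{δ_ψ,c} has strictly smaller Kullback–Leibler risk than q_{δ_ψ,1} at every θ with θ1 − θ2 ∈ A. Moreover c₀(1 + R̲) ≥ (1 + R̲)² ≥ (1 + σ1²σ2²/(σ_Y²(σ1²+σ2²)))². -/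

import Mathlib

open MeasureTheory Real Set

noncomputable section

abbrev Ep (p : ℕ) := EuclideanSpace ℝ (Fin p)

/-- Density of `N_p(0, v I_p)` evaluated at `u`. -/
def gdens (p : ℕ) (v : ℝ) (u : Ep p) : ℝ :=
  (2 * Real.pi * v) ^ (-(p : ℝ) / 2) * Real.exp (-‖u‖ ^ 2 / (2 * v))

/-- Joint density of `X = (X1, X2)`. -/
def jointDens (p : ℕ) (σ12 σ22 : ℝ) (θ1 θ2 : Ep p) (x : Ep p × Ep p) : ℝ :=
  gdens p σ12 (x.1 - θ1) * gdens p σ22 (x.2 - θ2)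

/-- Kullback–Leibler risk. -/
def klRisk (p : ℕ) (σ12 σ22 σY2 : ℝ) (θ1 θ2 : Ep p)
    (qhat : Ep p × Ep p → Ep p → ℝ) : ℝ :=
  ∫ x : Ep p × Ep p,
    (∫ y : Ep p, gdens p σY2 (y - θ1) *
      Real.log (gdens p σY2 (y - θ1) / qhat x y)) *
    jointDens p σ12 σ22 θ1 θ2 x

/-- The estimator `δ_ψ(X) = W2 + ψ(W1)`. -/
def deltaEst (p : ℕ) (r : ℝ) (ψ : Ep p → Ep p) (x : Ep p × Ep p) : Ep p :=
  (1 + r)⁻¹ • (r • x.1 + x.2) + ψ ((1 + r)⁻¹ • (x.1 - x.2))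

open ProbabilityTheory in
lemma gdens_toLp {p : ℕ} {v : ℝ} (hv : 0 < v) (x : Fin p → ℝ) :
    gdens p v (WithLp.toLp 2 x) = ∏ i, gaussianPDFReal 0 v.toNNReal (x i) := by
  have h2 : 0 < 2 * Real.pi * v := by positivity
  simp only [gdens, gaussianPDFReal_def, Finset.prod_mul_distrib, ← Real.exp_sum,
    Finset.prod_const, Finset.card_univ, Fintype.card_fin, Real.coe_toNNReal v hv.le, sub_zero,
    EuclideanSpace.real_norm_sq_eq, ← Finset.sum_div, Finset.sum_neg_distrib]
  congr 1
  rw [Real.sqrt_eq_rpow, ← Real.rpow_neg h2.le, ← Real.rpow_natCast, ← Real.rpow_mul h2.le]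
  congr 1
  ring

lemma gdens_pos {p : ℕ} {v : ℝ} (hv : 0 < v) (u : Ep p) : 0 < gdens p v u := by
  unfold gdens
  positivity

lemma gdens_neg {p : ℕ} (v : ℝ) (u : Ep p) : gdens p v (-u) = gdens p v u := by
  simp [gdens]

open ProbabilityTheory in
lemma integral_sq_mul_gaussianPDFReal {v : ℝ} (hv : 0 < v) :
    Integrable (fun x : ℝ => x ^ 2 * gaussianPDFReal 0 v.toNNReal x) ∧
      ∫ x : ℝ, x ^ 2 * gaussianPDFReal 0 v.toNNReal x = v := by
  have hv' : v.toNNReal ≠ 0 := by simpa using hv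
  have h : ∫ x : ℝ, x ^ 2 * gaussianPDFReal 0 v.toNNReal x = v := by
    have := variance_fun_id_gaussianReal (μ := 0) (v := v.toNNReal)
    rw [variance_eq_integral (by fun_prop), integral_gaussianReal_eq_integral_smul hv'] at this
    simpa [integral_id_gaussianReal, mul_comm, hv.le] using this
  refine ⟨?_, h⟩
  by_contra hc
  rw [integral_undef hc] at h
  exact hv.ne h

open ProbabilityTheory in
lemma integral_gdens {p : ℕ} {v : ℝ} (hv : 0 < v) :
    Integrable (gdens p v) ∧ ∫ u, gdens p v u = 1 := by
  have hv' : v.toNNReal ≠ 0 := by simpa using hv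
  have h : ∫ u, gdens p v u = 1 := by
    rw [← (PiLp.volume_preserving_toLp (Fin p)).integral_comp
      (MeasurableEquiv.toLp 2 _).measurableEmbedding]
    simp [gdens_toLp hv, integral_fintype_prod_volume_eq_prod, integral_gaussianPDFReal_eq_one 0 hv']
  refine ⟨?_, h⟩
  by_contra hc
  rw [integral_undef hc] at h
  exact zero_ne_one h

open ProbabilityTheory in
lemma integral_norm_sq_mul_gdens {p : ℕ} {v : ℝ} (hv : 0 < v) :
    Integrable (fun u => ‖u‖ ^ 2 * gdens p v u) ∧ ∫ u, ‖u‖ ^ 2 * gdens p v u = p * v := by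
  have hv' : v.toNNReal ≠ 0 := by simpa using hv
  let f : Fin p → Fin p → ℝ → ℝ := fun i j t =>
    (if j = i then t ^ 2 else 1) * gaussianPDFReal 0 v.toNNReal t
  have hf : ∀ i j, Integrable (f i j) := by
    intro i j
    by_cases hij : j = i
    · simpa [f, hij] using (integral_sq_mul_gaussianPDFReal hv).1
    · simpa [f, hij] using integrable_gaussianPDFReal 0 v.toNNReal
  have hfi : ∀ i j, ∫ t, f i j t = if j = i then v else 1 := by
    intro i j
    by_cases hij : j = i
    · simpa [f, hij] using (integral_sq_mul_gaussianPDFReal hv).2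
    · simpa [f, hij] using integral_gaussianPDFReal_eq_one 0 hv'
  have key : ∀ x : Fin p → ℝ, ‖WithLp.toLp 2 x‖ ^ 2 * gdens p v (WithLp.toLp 2 x) =
      ∑ i, ∏ j, f i j (x j) := by
    intro x
    simp only [f, gdens_toLp hv, EuclideanSpace.real_norm_sq_eq, Finset.prod_mul_distrib,
      Finset.sum_mul, Finset.prod_ite_eq', Finset.mem_univ, if_true]
  have hint : ∀ i ∈ Finset.univ, Integrable (fun x : Fin p → ℝ => ∏ j, f i j (x j)) :=
    fun i _ => Integrable.fintype_prod (hf i)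
  constructor
  · rw [← (PiLp.volume_preserving_toLp (Fin p)).integrable_comp_emb
      (MeasurableEquiv.toLp 2 _).measurableEmbedding]
    exact (integrable_finsetSum _ hint).congr (.of_forall fun x => (key x).symm)
  · rw [← (PiLp.volume_preserving_toLp (Fin p)).integral_comp
      (MeasurableEquiv.toLp 2 _).measurableEmbedding]
    simp only [key]
    rw [integral_finsetSum _ hint]
    simp [integral_fintype_prod_volume_eq_prod, hfi]

/-- Second moment of a Gaussian vector about an arbitrary point. -/
lemma integral_norm_add_sq_mul_gdens {p : ℕ} {v : ℝ} (hv : 0 < v) (b : Ep p) :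
    Integrable (fun u => ‖u + b‖ ^ 2 * gdens p v u) ∧
      ∫ u, ‖u + b‖ ^ 2 * gdens p v u = p * v + ‖b‖ ^ 2 := by
  obtain ⟨h0, h0'⟩ := integral_gdens (p := p) hv
  obtain ⟨h2, h2'⟩ := integral_norm_sq_mul_gdens (p := p) hv
  have hs : Integrable (fun u => 2 * (‖u‖ ^ 2 * gdens p v u) + 2 * ‖b‖ ^ 2 * gdens p v u) :=
    (h2.const_mul 2).add (h0.const_mul _)
  have hpar : ∀ u : Ep p, ‖u + b‖ ^ 2 + ‖-u + b‖ ^ 2 = 2 * ‖u‖ ^ 2 + 2 * ‖b‖ ^ 2 := by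
    intro u
    have := parallelogram_law_with_norm ℝ b u
    rw [neg_add_eq_sub, add_comm u b]
    linarith
  have hmeas : Measurable (gdens p v) := by unfold gdens; fun_prop
  have hi : Integrable (fun u => ‖u + b‖ ^ 2 * gdens p v u) := by
    refine hs.mono' (by fun_prop) (.of_forall fun u => ?_)
    have h1 := hpar u
    have h3 := gdens_pos hv u
    rw [Real.norm_of_nonneg (by positivity)]
    nlinarith [mul_nonneg (sq_nonneg ‖-u + b‖) h3.le]
  refine ⟨hi, ?_⟩
  have hneg : ∫ u, ‖-u + b‖ ^ 2 * gdens p v u = ∫ u, ‖u + b‖ ^ 2 * gdens p v u := by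
    rw [← integral_neg_eq_self]
    simp [gdens_neg]
  have hin : Integrable (fun u => ‖-u + b‖ ^ 2 * gdens p v u) := by
    simpa [gdens_neg] using hi.comp_neg
  have : ∫ u, (‖u + b‖ ^ 2 * gdens p v u + ‖-u + b‖ ^ 2 * gdens p v u) =
      2 * (p * v) + 2 * ‖b‖ ^ 2 := by
    simp_rw [← add_mul, hpar, add_mul, mul_assoc]
    rw [integral_add (h2.const_mul 2) ((h0.const_mul _).const_mul 2)]
    simp only [integral_const_mul, h0', h2', mul_one]
  rw [integral_add hi hin, hneg] at this
  linarith

lemma log_gdens {p : ℕ} {v : ℝ} (hv : 0 < v) (u : Ep p) :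
    Real.log (gdens p v u) = -(p : ℝ) / 2 * Real.log (2 * Real.pi * v) - ‖u‖ ^ 2 / (2 * v) := by
  have h2 : 0 < 2 * Real.pi * v := by positivity
  rw [gdens, Real.log_mul (by positivity) (by positivity), Real.log_rpow h2, Real.log_exp]
  ring

/-- The Kullback–Leibler divergence of `N_p(δ, c s I_p)` from `N_p(θ, s I_p)`. -/
lemma integral_gdens_mul_log_div {p : ℕ} {s c : ℝ} (hs : 0 < s) (hc : 0 < c) (θ δ : Ep p) :
    ∫ y, gdens p s (y - θ) * Real.log (gdens p s (y - θ) / gdens p (c * s) (y - δ)) =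
      p / 2 * (Real.log c + 1 / c - 1) + ‖δ - θ‖ ^ 2 / (2 * c * s) := by
  rw [← integral_add_right_eq_self _ θ]
  obtain ⟨h0, h0'⟩ := integral_gdens (p := p) hs
  obtain ⟨h2, h2'⟩ := integral_norm_sq_mul_gdens (p := p) hs
  obtain ⟨h1, h1'⟩ := integral_norm_add_sq_mul_gdens hs (θ - δ)
  have key : ∀ y : Ep p, gdens p s (y + θ - θ) *
      Real.log (gdens p s (y + θ - θ) / gdens p (c * s) (y + θ - δ)) =
      p / 2 * Real.log c * gdens p s y - 1 / (2 * s) * (‖y‖ ^ 2 * gdens p s y) +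
        1 / (2 * c * s) * (‖y + (θ - δ)‖ ^ 2 * gdens p s y) := by
    intro y
    rw [Real.log_div (gdens_pos hs _).ne' (gdens_pos (mul_pos hc hs) _).ne', log_gdens hs,
      log_gdens (mul_pos hc hs), show 2 * Real.pi * (c * s) = c * (2 * Real.pi * s) by ring,
      Real.log_mul hc.ne' (by positivity), add_sub_cancel_right, add_sub_assoc]
    field_simp
    ring
  simp_rw [key]
  rw [integral_add (by exact (h0.const_mul _).sub (h2.const_mul _)) (h1.const_mul _),
    integral_sub (h0.const_mul _) (h2.const_mul _)]
  simp only [integral_const_mul, h0', h1', h2', norm_sub_rev δ θ]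
  field_simp
  ring

lemma integral_jointDens {p : ℕ} {s t : ℝ} (hs : 0 < s) (ht : 0 < t) (θ1 θ2 : Ep p) :
    Integrable (jointDens p s t θ1 θ2) ∧ ∫ x, jointDens p s t θ1 θ2 x = 1 := by
  have h1 := (integral_gdens (p := p) hs).1.comp_sub_right θ1
  have h2 := (integral_gdens (p := p) ht).1.comp_sub_right θ2
  refine ⟨h1.mul_prod h2, ?_⟩
  have := integral_prod_mul (μ := volume) (ν := volume)
    (fun x : Ep p => gdens p s (x - θ1)) (fun x : Ep p => gdens p t (x - θ2))
  rw [integral_sub_right_eq_self, integral_sub_right_eq_self, (integral_gdens hs).2,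
    (integral_gdens ht).2, mul_one] at this
  exact this

/-- Kullback–Leibler risk of a variance expansion of a plug-in density. -/
lemma klRisk_gdens {p : ℕ} {s t v c : ℝ} (hs : 0 < s) (ht : 0 < t) (hv : 0 < v) (hc : 0 < c)
    (θ1 θ2 : Ep p) (δ : Ep p × Ep p → Ep p)
    (hδ : Integrable (fun x => ‖δ x - θ1‖ ^ 2 * jointDens p s t θ1 θ2 x)) :
    klRisk p s t v θ1 θ2 (fun x y => gdens p (c * v) (y - δ x)) =
      p / 2 * (Real.log c + 1 / c - 1) +
        (∫ x, ‖δ x - θ1‖ ^ 2 * jointDens p s t θ1 θ2 x) / (2 * c * v) := by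
  obtain ⟨h0, h0'⟩ := integral_jointDens hs ht θ1 θ2
  simp only [klRisk, integral_gdens_mul_log_div hv hc, add_mul, div_mul_eq_mul_div _ (2 * c * v)]
  rw [integral_add (h0.const_mul _) (hδ.div_const _), integral_div, integral_const_mul, h0',
    mul_one]

/-- Standardizing change of variables `(w1, w2) ↦ (w1 + w2, w2 - r w1)`. -/
def pairEquiv (p : ℕ) {r : ℝ} (hr : 0 < 1 + r) : (Ep p × Ep p) ≃L[ℝ] (Ep p × Ep p) :=
  LinearEquiv.toContinuousLinearEquiv
  { toFun := fun w => (w.1 + w.2, w.2 - r • w.1)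
    invFun := fun x => ((1 + r)⁻¹ • (x.1 - x.2), (1 + r)⁻¹ • (r • x.1 + x.2))
    map_add' := by
      intro a b
      ext1 <;> simp only [Prod.fst_add, Prod.snd_add] <;> module
    map_smul' := by
      intro a b
      ext1 <;> simp only [Prod.smul_fst, Prod.smul_snd, RingHom.id_apply] <;> module
    left_inv := by
      intro w
      ext1
      · simp only
        rw [inv_smul_eq_iff₀ hr.ne']
        module
      · simp only
        rw [inv_smul_eq_iff₀ hr.ne']
        module
    right_inv := by
      intro x
      ext1 <;> simp only
      · rw [← smul_add, inv_smul_eq_iff₀ hr.ne']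
        module
      · rw [smul_comm, ← smul_sub, inv_smul_eq_iff₀ hr.ne']
        module }

lemma pairEquiv_apply {p : ℕ} {r : ℝ} (hr : 0 < 1 + r) (w : Ep p × Ep p) :
    pairEquiv p hr w = (w.1 + w.2, w.2 - r • w.1) := rfl

lemma pairEquiv_symm_apply {p : ℕ} {r : ℝ} (hr : 0 < 1 + r) (x : Ep p × Ep p) :
    (pairEquiv p hr).symm x =
      ((1 + r)⁻¹ • (x.1 - x.2), (1 + r)⁻¹ • (r • x.1 + x.2)) := rfl

lemma jointDens_pairEquiv {p : ℕ} {s t r : ℝ} (hs : 0 < s) (ht : 0 < t) (hr : r = t / s)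
    (hr0 : 0 < 1 + r) (m : Ep p × Ep p) :
    ∃ a : ℝ, ∀ w, jointDens p s t (pairEquiv p hr0 m).1 (pairEquiv p hr0 m).2
        (pairEquiv p hr0 w) =
      a * jointDens p (s / (1 + r)) (t / (1 + r)) m.1 m.2 w := by
  have hC : ∀ {v : ℝ}, 0 < v → (2 * Real.pi * v) ^ (-(p : ℝ) / 2) ≠ 0 := by
    intro v hv
    positivity
  refine ⟨(2 * Real.pi * s) ^ (-(p : ℝ) / 2) * (2 * Real.pi * t) ^ (-(p : ℝ) / 2) /
    ((2 * Real.pi * (s / (1 + r))) ^ (-(p : ℝ) / 2) *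
      (2 * Real.pi * (t / (1 + r))) ^ (-(p : ℝ) / 2)), fun w => ?_⟩
  have h1 : w.1 + w.2 - (m.1 + m.2) = (w.1 - m.1) + (w.2 - m.2) := by abel
  have h2 : w.2 - r • w.1 - (m.2 - r • m.1) = (w.2 - m.2) - r • (w.1 - m.1) := by module
  have hts : t = r * s := by rw [hr]; field_simp
  have hrp : 0 < r := by rw [hr]; positivity
  have hexp : ∀ u v : Ep p, -‖u + v‖ ^ 2 / (2 * s) + -‖v - r • u‖ ^ 2 / (2 * t) =
      -‖u‖ ^ 2 / (2 * (s / (1 + r))) + -‖v‖ ^ 2 / (2 * (t / (1 + r))) := by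
    intro u v
    rw [norm_add_sq_real, norm_sub_sq_real, inner_smul_right, real_inner_comm u v, norm_smul,
      mul_pow, Real.norm_eq_abs, sq_abs, hts]
    field_simp
    ring
  have hE := congrArg Real.exp (hexp (w.1 - m.1) (w.2 - m.2))
  rw [Real.exp_add, Real.exp_add] at hE
  have hC1 := hC (div_pos hs hr0)
  have hC2 := hC (div_pos ht hr0)
  simp only [jointDens, gdens, pairEquiv_apply, h1, h2]
  rw [mul_mul_mul_comm, hE]
  generalize (2 * Real.pi * (s / (1 + r))) ^ (-(p : ℝ) / 2) = C1 at *
  generalize (2 * Real.pi * (t / (1 + r))) ^ (-(p : ℝ) / 2) = C2 at *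
  field_simp

/-- A linear automorphism changes Lebesgue integrals by a constant factor. -/
lemma exists_integral_comp_equiv {E : Type*} [NormedAddCommGroup E] [NormedSpace ℝ E]
    [FiniteDimensional ℝ E] [MeasurableSpace E] [BorelSpace E] (μ : Measure E)
    [μ.IsAddHaarMeasure] (e : E ≃L[ℝ] E) :
    ∃ k : ℝ, (∀ F : E → ℝ, ∫ x, F x ∂μ = k * ∫ w, F (e w) ∂μ) ∧
      ∀ F : E → ℝ, Integrable F μ → Integrable (fun w => F (e w)) μ := by
  have : ProperSpace E := FiniteDimensional.proper ℝ E
  have hm := Measure.isAddLeftInvariant_eq_smul (μ.map e.symm) μ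
  have hk := Measure.addHaarScalarFactor_pos_of_isAddHaarMeasure (μ.map e.symm) μ
  have hemb : MeasurableEmbedding e.symm := e.symm.toHomeomorph.measurableEmbedding
  refine ⟨Measure.addHaarScalarFactor (μ.map e.symm) μ, fun F => ?_, fun F hF => ?_⟩
  · have h := hemb.integral_map (μ := μ) (fun w => F (e w))
    simp only [ContinuousLinearEquiv.apply_symm_apply] at h
    rw [← h]
    conv_lhs => rw [hm]
    rw [integral_smul_nnreal_measure]
    rfl
  · have h : Integrable (fun w => F (e w)) (μ.map e.symm) := by
      rw [hemb.integrable_map_iff]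
      simpa [Function.comp_def] using hF
    rw [hm] at h
    exact (integrable_smul_measure (ENNReal.coe_ne_zero.2 hk.ne') ENNReal.coe_ne_top).1 h

/-- Risk decomposition of `δ_ψ`. -/
lemma integral_deltaEst {p : ℕ} {s t r : ℝ} (hs : 0 < s) (ht : 0 < t) (hr : r = t / s)
    (ψ : Ep p → Ep p) (θ1 θ2 : Ep p)
    (hX : Integrable (fun x => ‖deltaEst p r ψ x - θ1‖ ^ 2 * jointDens p s t θ1 θ2 x))
    (hW : Integrable (fun w : Ep p => ‖ψ w - (1 + r)⁻¹ • (θ1 - θ2)‖ ^ 2 *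
      gdens p (s / (1 + r)) (w - (1 + r)⁻¹ • (θ1 - θ2)))) :
    ∫ x, ‖deltaEst p r ψ x - θ1‖ ^ 2 * jointDens p s t θ1 θ2 x =
      p * (s * t / (s + t)) + ∫ w : Ep p, ‖ψ w - (1 + r)⁻¹ • (θ1 - θ2)‖ ^ 2 *
        gdens p (s / (1 + r)) (w - (1 + r)⁻¹ • (θ1 - θ2)) := by
  have hr0 : 0 < 1 + r := by rw [hr]; positivity
  have hs' := div_pos hs hr0
  have ht' := div_pos ht hr0
  obtain ⟨⟨μ1, μ2⟩, hm⟩ := (pairEquiv p hr0).surjective (θ1, θ2)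
  obtain ⟨a, ha⟩ := jointDens_pairEquiv hs ht hr hr0 (μ1, μ2)
  obtain ⟨k, hk, hk'⟩ := exists_integral_comp_equiv
    ((volume : Measure (Ep p)).prod (volume : Measure (Ep p))) (pairEquiv p hr0)
  have hμ1 : (1 + r)⁻¹ • (θ1 - θ2) = μ1 := by
    have := congrArg Prod.fst (congrArg (pairEquiv p hr0).symm hm)
    rw [ContinuousLinearEquiv.symm_apply_apply, pairEquiv_symm_apply] at this
    exact this.symm
  rw [hμ1] at hW ⊢
  rw [hm] at ha
  have hθ1 : θ1 = μ1 + μ2 := by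
    rw [pairEquiv_apply] at hm
    exact (congrArg Prod.fst hm).symm
  have hδ : ∀ w, deltaEst p r ψ (pairEquiv p hr0 w) - θ1 = (w.2 - μ2) + (ψ w.1 - μ1) := by
    intro w
    have h := (pairEquiv p hr0).symm_apply_apply w
    rw [pairEquiv_symm_apply, Prod.ext_iff] at h
    dsimp only at h
    rw [deltaEst, h.1, h.2, hθ1]
    abel
  have hka : k * a = 1 := by
    have h := hk (jointDens p s t θ1 θ2)
    simp only [ha] at h
    rw [← Measure.volume_eq_prod, integral_const_mul, (integral_jointDens hs ht θ1 θ2).2,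
      (integral_jointDens hs' ht' _ _).2] at h
    linarith
  have ha0 : a ≠ 0 := right_ne_zero_of_mul_eq_one hka
  have hG := (hk' _ hX).const_mul a⁻¹
  rw [Measure.volume_eq_prod, hk]
  simp only [ha, hδ] at hG ⊢
  simp only [mul_left_comm _ a, mul_inv_cancel_left₀ ha0] at hG ⊢
  rw [integral_const_mul, ← mul_assoc, hka, one_mul]
  have hinner : ∀ w1 : Ep p, ∫ w2, ‖(w2 - μ2) + (ψ w1 - μ1)‖ ^ 2 *
        jointDens p (s / (1 + r)) (t / (1 + r)) μ1 μ2 (w1, w2) =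
      p * (t / (1 + r)) * gdens p (s / (1 + r)) (w1 - μ1) +
        ‖ψ w1 - μ1‖ ^ 2 * gdens p (s / (1 + r)) (w1 - μ1) := by
    intro w1
    simp only [jointDens, mul_left_comm _ (gdens p (s / (1 + r)) (w1 - μ1))]
    rw [integral_const_mul, integral_sub_right_eq_self
      (fun u => ‖u + (ψ w1 - μ1)‖ ^ 2 * gdens p (t / (1 + r)) u),
      (integral_norm_add_sq_mul_gdens ht' _).2]
    ring
  rw [integral_prod _ hG]
  simp only [hinner]
  have h0 := integral_gdens (p := p) hs'
  rw [integral_add ((h0.1.comp_sub_right μ1).const_mul _) hW, integral_const_mul,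
    integral_sub_right_eq_self, h0.2, hr]
  field_simp

/-- The gain `c ↦ (1 - 1/c) s - log c` is concave in `1/c` and vanishes at `c = 1`. -/
lemma gain_pos_of_lt {s c d : ℝ} (hc : 1 < c) (hcd : c < d)
    (hd : 0 ≤ (1 - 1 / d) * s - Real.log d) : 0 < (1 - 1 / c) * s - Real.log c := by
  have hc0 : 0 < c := by linarith
  have hd0 : 0 < d := by linarith
  have hd1 : 1 < d := hc.trans hcd
  set t := (1 - c⁻¹) / (1 - d⁻¹) with ht
  have hdi : 0 < 1 - d⁻¹ := sub_pos.2 (inv_lt_one_of_one_lt₀ hd1)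
  have hci : 0 < 1 - c⁻¹ := sub_pos.2 (inv_lt_one_of_one_lt₀ hc)
  have hinv : d⁻¹ < c⁻¹ := inv_strictAnti₀ hc0 hcd
  have ht0 : 0 < t := div_pos hci hdi
  have ht1 : t < 1 := (div_lt_one hdi).2 (by linarith)
  have htd : t * (1 - d⁻¹) = 1 - c⁻¹ := div_mul_cancel₀ _ hdi.ne'
  have h := strictConcaveOn_log_Ioi.2 (mem_Ioi.2 (inv_pos.2 hd0)) (mem_Ioi.2 one_pos)
    (inv_lt_one_of_one_lt₀ hd1).ne ht0 (sub_pos.2 ht1) (by ring)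
  have hcomb : t • d⁻¹ + (1 - t) • (1 : ℝ) = c⁻¹ := by
    simp only [smul_eq_mul]
    linarith
  rw [hcomb] at h
  simp only [smul_eq_mul, Real.log_inv, Real.log_one, mul_zero, add_zero] at h
  simp only [one_div] at hd ⊢
  have := mul_nonneg ht0.le hd
  rw [mul_sub, ← mul_assoc, htd] at this
  linarith

lemma gain_sq_nonneg {s : ℝ} (hs : 1 ≤ s) : 0 ≤ (1 - 1 / s ^ 2) * s - Real.log (s ^ 2) := by
  have h := Real.self_le_sinh_iff.2 (Real.log_nonneg hs)
  rw [Real.sinh_log (by linarith)] at h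
  rw [Real.log_pow]
  have : (1 - 1 / s ^ 2) * s = s - s⁻¹ := by field_simp
  rw [this]
  push_cast
  linarith

/-- Variance expansion improvements on the plug-in density `N_p(δ_ψ(X), σY² I)`, with
`R̲` computed via the risk decomposition, together with the lower bounds
`c₀(1 + R̲) ≥ (1 + R̲)² ≥ (1 + σ1²σ2²/(σY²(σ1²+σ2²)))²`. -/
theorem stmt5 (p : ℕ) (hp : 0 < p) (σ12 σ22 σY2 : ℝ)
    (hσ1 : 0 < σ12) (hσ2 : 0 < σ22) (hσY : 0 < σY2)
    (A : Set (Ep p)) (hA : MeasurableSet A)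
    (r : ℝ) (hr : r = σ22 / σ12)
    (ψ : Ep p → Ep p) (hψ : Measurable ψ)
    (hne : {ρ : ℝ | ∃ μ1 : Ep p, (1 + r) • μ1 ∈ A ∧
      ρ = ∫ w : Ep p, ‖ψ w - μ1‖ ^ 2 * gdens p (σ12 / (1 + r)) (w - μ1)}.Nonempty)
    (hbdd : BddAbove {ρ : ℝ | ∃ μ1 : Ep p, (1 + r) • μ1 ∈ A ∧
      ρ = ∫ w : Ep p, ‖ψ w - μ1‖ ^ 2 * gdens p (σ12 / (1 + r)) (w - μ1)})
    (hintW : ∀ μ1 : Ep p, (1 + r) • μ1 ∈ A →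
      Integrable (fun w : Ep p => ‖ψ w - μ1‖ ^ 2 * gdens p (σ12 / (1 + r)) (w - μ1)))
    (hintX : ∀ θ1 θ2 : Ep p, θ1 - θ2 ∈ A →
      Integrable (fun x : Ep p × Ep p =>
        ‖deltaEst p r ψ x - θ1‖ ^ 2 * jointDens p σ12 σ22 θ1 θ2 x))
    (Rlow : ℝ)
    (hRlow : Rlow = (1 / σY2) * (σ12 * σ22 / (σ12 + σ22) +
      (1 / (p : ℝ)) * sInf {ρ : ℝ | ∃ μ1 : Ep p, (1 + r) • μ1 ∈ A ∧
        ρ = ∫ w : Ep p, ‖ψ w - μ1‖ ^ 2 * gdens p (σ12 / (1 + r)) (w - μ1)}))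
    (c₀ : ℝ) (hc₀mem : 1 + Rlow < c₀)
    (hc₀root : (1 - 1 / c₀) * (1 + Rlow) - Real.log c₀ = 0) :
    (∀ c : ℝ, 1 < c → c < c₀ →
      ∀ θ1 θ2 : Ep p, θ1 - θ2 ∈ A →
        klRisk p σ12 σ22 σY2 θ1 θ2
            (fun x y => gdens p (c * σY2) (y - deltaEst p r ψ x)) <
        klRisk p σ12 σ22 σY2 θ1 θ2
            (fun x y => gdens p σY2 (y - deltaEst p r ψ x))) ∧
    (1 + Rlow) ^ 2 ≤ c₀ ∧
    (1 + σ12 * σ22 / (σY2 * (σ12 + σ22))) ^ 2 ≤ (1 + Rlow) ^ 2 := by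
  have hr0 : 0 < 1 + r := by rw [hr]; positivity
  have hp' : (0 : ℝ) < p := Nat.cast_pos.2 hp
  set S := {ρ : ℝ | ∃ μ1 : Ep p, (1 + r) • μ1 ∈ A ∧
    ρ = ∫ w : Ep p, ‖ψ w - μ1‖ ^ 2 * gdens p (σ12 / (1 + r)) (w - μ1)} with hS
  have hSnn : ∀ ρ ∈ S, 0 ≤ ρ := by
    rintro ρ ⟨μ1, -, rfl⟩
    exact integral_nonneg fun w => mul_nonneg (sq_nonneg _) (gdens_pos (div_pos hσ1 hr0) _).le
  have hinf : 0 ≤ sInf S := Real.sInf_nonneg hSnn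
  have hK : 0 < σ12 * σ22 / (σY2 * (σ12 + σ22)) := by positivity
  have hRK : σ12 * σ22 / (σY2 * (σ12 + σ22)) ≤ Rlow := by
    have : Rlow = σ12 * σ22 / (σY2 * (σ12 + σ22)) + 1 / σY2 * (1 / p * sInf S) := by
      rw [hRlow]
      field_simp
    rw [this]
    exact le_add_of_nonneg_right (by positivity)
  refine ⟨fun c hc1 hcc θ1 θ2 hθ => ?_, ?_, ?_⟩
  · have hc0 : 0 < c := by linarith
    have hX := hintX θ1 θ2 hθ
    have hμ : (1 + r) • (1 + r)⁻¹ • (θ1 - θ2) ∈ A := by rwa [smul_inv_smul₀ hr0.ne']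
    have hdec := integral_deltaEst hσ1 hσ2 hr ψ θ1 θ2 hX (hintW _ hμ)
    have hle : sInf S ≤ _ := csInf_le ⟨0, hSnn⟩ ⟨_, hμ, rfl⟩
    have hplug := klRisk_gdens hσ1 hσ2 hσY one_pos θ1 θ2 (deltaEst p r ψ) hX
    rw [one_mul] at hplug
    rw [hplug, klRisk_gdens hσ1 hσ2 hσY hc0 θ1 θ2 (deltaEst p r ψ) hX, hdec]
    have hgain := gain_pos_of_lt hc1 hcc hc₀root.ge
    set I := ∫ w : Ep p, ‖ψ w - (1 + r)⁻¹ • (θ1 - θ2)‖ ^ 2 *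
      gdens p (σ12 / (1 + r)) (w - (1 + r)⁻¹ • (θ1 - θ2))
    have hRI : p * σY2 * Rlow ≤ p * (σ12 * σ22 / (σ12 + σ22)) + I := by
      have : p * σY2 * Rlow = p * (σ12 * σ22 / (σ12 + σ22)) + sInf S := by
        rw [hRlow]
        field_simp
      linarith
    set J := p * (σ12 * σ22 / (σ12 + σ22)) + I
    have hci : 0 < 1 - 1 / c := sub_pos.2 ((div_lt_one hc0).2 hc1)
    have hJ : Rlow ≤ J / (p * σY2) := by
      rw [le_div_iff₀ (by positivity)]
      linarith
    have hlog : 0 < p / 2 * ((1 - 1 / c) * (1 + J / (p * σY2)) - Real.log c) := by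
      refine mul_pos (by positivity) (hgain.trans_le ?_)
      gcongr
    have hdiff : p / 2 * (Real.log 1 + 1 / 1 - 1) + J / (2 * 1 * σY2) -
        (p / 2 * (Real.log c + 1 / c - 1) + J / (2 * c * σY2)) =
        p / 2 * ((1 - 1 / c) * (1 + J / (p * σY2)) - Real.log c) := by
      rw [Real.log_one]
      field_simp
      ring
    linarith
  · by_contra! hlt
    have := gain_pos_of_lt (s := 1 + Rlow) (by linarith) hlt (gain_sq_nonneg (by linarith))
    linarith
  · gcongr

end
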